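/- The space K_3^{(4)} is one-dimensional, spanned by f_3 = [2|2|0] − (2/3)[3|1|0], and moreover δ_3(f_3) = 0. -/

import Mathlib

open Finset

/-- A list `[m_1, …, m_n]` of natural numbers is an Anick chain if it is nonempty,
`m_j ≥ 2` for all `1 ≤ j ≤ n-2`, and (when `n ≥ 2`) either `m_{n-1} ≥ 2` or
`(m_{n-1}, m_n) = (1, 0)`. -/
def AnickChain (l : List ℕ) : Prop :=
  l ≠ [] ∧ (∀ j, j + 2 < l.length → 2 ≤ l.getD j 0) ∧
    (2 ≤ l.length →
      2 ≤ l.getD (l.length - 2) 0 ∨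
        (l.getD (l.length - 2) 0 = 1 ∧ l.getD (l.length - 1) 0 = 0))

/-- The ℚ-vector space with basis the set of all Anick chains (of all lengths);
its length-homogeneous components are the spaces `A_n`. -/
abbrev AnickSpace : Type := {l : List ℕ // AnickChain l} →₀ ℚ

open Classical in
/-- The basis element `[m_1|…|m_n]` attached to a list; by convention it is `0`
if the list is not an Anick chain. -/
noncomputable def br (l : List ℕ) : AnickSpace :=
  if h : AnickChain l then Finsupp.single ⟨l, h⟩ 1 else 0

/-- The `j`-th entry of a list, `1`-based (with default value 0). -/
def ent (l : List ℕ) (j : ℕ) : ℕ := l.getD (j - 1) 0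

/-- Replace the pair of entries at (1-based) positions `j, j+1` by the single entry `c`. -/
def mergeAt (l : List ℕ) (j c : ℕ) : List ℕ := l.take (j - 1) ++ c :: l.drop (j + 1)

/-- Decrease the (1-based) `t`-th entry by one. -/
def decAt (l : List ℕ) (t : ℕ) : List ℕ := l.set (t - 1) (ent l t - 1)

open Classical in
/-- The value of the Anick differential on the basis chain `[i_1|…|i_{n+1}]`. -/
noncomputable def deltaFun (l : List ℕ) : AnickSpace :=
  let n := l.length - 1
  let i : ℕ → ℚ := fun j => (ent l j : ℚ)
  if 2 ≤ ent l n then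
    (∑ j ∈ Icc 1 n, ((-1 : ℚ) ^ j * (i j * (i j - 1) / (i j + i (j + 1) - 1))) •
        br (mergeAt l j (ent l j + ent l (j + 1) - 1)))
    + (∑ j ∈ Icc 2 n, ∑ t ∈ Icc 1 (j - 1),
        ((-1 : ℚ) ^ j * (i t * (i j - 1) * (i (j + 1) - 1) / (i j + i (j + 1) - 1))) •
          br (mergeAt (decAt l t) j (ent l j + ent l (j + 1))))
    + (∑ j ∈ Icc 2 n, ∑ t ∈ Icc 1 (j - 1),
        ((-1 : ℚ) ^ j * (i j * i (j + 1) * (i t - 1) / (i j + i (j + 1) - 1))) •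
          br (mergeAt l j (ent l j + ent l (j + 1) - 1)))
  else if ent l n = 1 ∧ ent l (n + 1) = 0 then
    (∑ j ∈ Icc 1 (n - 2), ((-1 : ℚ) ^ j * (i j * (i j - 1) / (i j + i (j + 1) - 1))) •
        br (mergeAt l j (ent l j + ent l (j + 1) - 1)))
    + (∑ j ∈ Icc 2 (n - 2), ∑ t ∈ Icc 1 (j - 1),
        ((-1 : ℚ) ^ j * (i t * (i j - 1) * (i (j + 1) - 1) / (i j + i (j + 1) - 1))) •
          br (mergeAt (decAt l t) j (ent l j + ent l (j + 1))))
    + (∑ j ∈ Icc 2 (n - 2), ∑ t ∈ Icc 1 (j - 1),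
        ((-1 : ℚ) ^ j * (i j * i (j + 1) * (i t - 1) / (i j + i (j + 1) - 1))) •
          br (mergeAt l j (ent l j + ent l (j + 1) - 1)))
    + (∑ j ∈ Icc 1 (n - 1), ((-1 : ℚ) ^ n * i j) • br ((decAt l j).dropLast))
    + (∑ j ∈ Icc 1 (n - 1), ((-1 : ℚ) ^ (n - 1) * (i j - 1)) • br (l.take (n - 1) ++ [0]))
    + ((-1 : ℚ) ^ n • br (l.take (n - 1) ++ [0]))
  else 0

/-- The Anick differential `δ` (the direct sum of all the maps `δ_n`; on the
length-one component it vanishes, i.e. `δ_1 = 0`). -/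
noncomputable def anickDelta : AnickSpace →ₗ[ℚ] AnickSpace :=
  Finsupp.linearCombination ℚ (fun c => deltaFun c.1)

/-- The value of `∂̃` on a basis chain. -/
noncomputable def dtilFun (l : List ℕ) : AnickSpace :=
  ∑ j ∈ Finset.range l.length, (l.getD j 0 : ℚ) • br (l.set j (l.getD j 0 - 1))

/-- The derivation `∂̃` on the Anick complex. -/
noncomputable def dtil : AnickSpace →ₗ[ℚ] AnickSpace :=
  Finsupp.linearCombination ℚ (fun c => dtilFun c.1)

/-- `A_n`: the span of the Anick chains of length `n`. -/
noncomputable def A (n : ℕ) : Submodule ℚ AnickSpace :=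
  Finsupp.supported ℚ ℚ {c | c.1.length = n}

/-- `A_{n,k}`: the span of the Anick chains of length `n` whose last entry is `≥ k`. -/
noncomputable def Ak (n k : ℕ) : Submodule ℚ AnickSpace :=
  Finsupp.supported ℚ ℚ {c | c.1.length = n ∧ k ≤ c.1.getD (n - 1) 0}

/-- `A_n^{(d)}`: the span of the Anick chains of length `n` and degree `d`. -/
noncomputable def Adeg (n d : ℕ) : Submodule ℚ AnickSpace :=
  Finsupp.supported ℚ ℚ {c | c.1.length = n ∧ c.1.sum = d}

/-- `A_n^{(d)∘}`: the span of the regular Anick chains (all entries `≥ 2`) of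
length `n` and degree `d`. -/
noncomputable def Areg (n d : ℕ) : Submodule ℚ AnickSpace :=
  Finsupp.supported ℚ ℚ {c | c.1.length = n ∧ c.1.sum = d ∧ ∀ j < n, 2 ≤ c.1.getD j 0}

/-- `K_n = ker ∂̃_n ⊆ A_n`. -/
noncomputable def K (n : ℕ) : Submodule ℚ AnickSpace := A n ⊓ LinearMap.ker dtil

/-- `K_n^{(d)} = K_n ∩ A_n^{(d)}`. -/
noncomputable def Kdeg (n d : ℕ) : Submodule ℚ AnickSpace := K n ⊓ Adeg n d

open Classical in
/-- The component map `a ↦ a_i`: keep only the chains whose last entry is `i`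
and delete that last entry. -/
noncomputable def component (i : ℕ) : AnickSpace →ₗ[ℚ] AnickSpace :=
  Finsupp.linearCombination ℚ
    (fun c => if c.1.getLast? = some i then br c.1.dropLast else 0)

/-- The elements `e_1 = [1|0]` and `e_d = Σ_{s=0}^{d-2} (-1)^s C(d,s) [d-s|s]` for `d ≥ 3`. -/
noncomputable def eElt (d : ℕ) : AnickSpace :=
  if d = 1 then br [1, 0]
  else ∑ s ∈ Finset.range (d - 1), ((-1 : ℚ) ^ s * (d.choose s : ℚ)) • br [d - s, s]

/-- The element `f_3 = [2|2|0] - (2/3)[3|1|0]`. -/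
noncomputable def f3 : AnickSpace := br [2, 2, 0] - (2 / 3 : ℚ) • br [3, 1, 0]

theorem anickChain_pair (a b : ℕ) :
    AnickChain [a, b] ↔ 2 ≤ a ∨ (a = 1 ∧ b = 0) := by
  simp [AnickChain]

theorem anickChain_triple (a b c : ℕ) :
    AnickChain [a, b, c] ↔ 2 ≤ a ∧ (2 ≤ b ∨ (b = 1 ∧ c = 0)) := by
  have hfirst : (∀ j, j + 2 < 3 → 2 ≤ [a, b, c].getD j 0) ↔ 2 ≤ a := by
    refine ⟨fun h => h 0 (by norm_num), fun h j hj => ?_⟩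
    obtain rfl : j = 0 := by omega
    exact h
  have hlast : (2 ≤ 3 → 2 ≤ b ∨ (b = 1 ∧ c = 0)) ↔ 2 ≤ b ∨ (b = 1 ∧ c = 0) := by simp
  exact (and_iff_right (List.cons_ne_nil _ _)).trans (and_congr hfirst hlast)

theorem br_of_chain {l : List ℕ} (h : AnickChain l) : br l = Finsupp.single ⟨l, h⟩ 1 :=
  dif_pos h

theorem br_of_not_chain {l : List ℕ} (h : ¬ AnickChain l) : br l = 0 :=
  dif_neg h

theorem dtil_br {l : List ℕ} (h : AnickChain l) : dtil (br l) = dtilFun l := by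
  simp [br_of_chain h, dtil]

theorem anickDelta_br {l : List ℕ} (h : AnickChain l) : anickDelta (br l) = deltaFun l := by
  simp [br_of_chain h, anickDelta]

theorem br_ne_zero {l : List ℕ} (h : AnickChain l) : br l ≠ 0 := by
  simp [br_of_chain h]

theorem br_mem_supported {l : List ℕ} {s : Set {l : List ℕ // AnickChain l}}
    (hs : ∀ h : AnickChain l, ⟨l, h⟩ ∈ s) : br l ∈ Finsupp.supported ℚ ℚ s := by
  by_cases h : AnickChain l
  · rw [br_of_chain h]
    exact Finsupp.single_mem_supported ℚ 1 (hs h)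
  · rw [br_of_not_chain h]
    exact Submodule.zero_mem _

/-- The only chains of length three and degree four are `[2|2|0]` and `[3|1|0]`. -/
theorem chain_three_four {l : List ℕ} (h : AnickChain l) (hl : l.length = 3)
    (hs : l.sum = 4) : l = [2, 2, 0] ∨ l = [3, 1, 0] := by
  obtain ⟨a, b, c, rfl⟩ := List.length_eq_three.mp hl
  rw [anickChain_triple] at h
  simp only [List.sum_cons, List.sum_nil] at hs
  simp only [List.cons.injEq, and_true]
  omega

theorem chain_two_two_zero : AnickChain [2, 2, 0] := by simp [anickChain_triple]

theorem chain_three_one_zero : AnickChain [3, 1, 0] := by simp [anickChain_triple]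

theorem Adeg_three_four_eq_span :
    Adeg 3 4 = Submodule.span ℚ {br [2, 2, 0], br [3, 1, 0]} := by
  have hset : {c : {l : List ℕ // AnickChain l} | c.1.length = 3 ∧ c.1.sum = 4} =
      {⟨[2, 2, 0], chain_two_two_zero⟩, ⟨[3, 1, 0], chain_three_one_zero⟩} := by
    ext ⟨l, h⟩
    simp only [Set.mem_ofPred_eq, Set.mem_insert_iff, Set.mem_singleton_iff, Subtype.mk.injEq]
    refine ⟨fun hl => chain_three_four h hl.1 hl.2, ?_⟩
    rintro (rfl | rfl) <;> simp
  rw [Adeg, hset, Finsupp.supported_eq_span_single, Set.image_pair,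
    br_of_chain chain_two_two_zero, br_of_chain chain_three_one_zero]

theorem dtil_two_two_zero : dtil (br [2, 2, 0]) = (2 : ℚ) • br [2, 1, 0] := by
  rw [dtil_br chain_two_two_zero]
  simp [dtilFun, Finset.sum_range_succ, br_of_not_chain, anickChain_triple]

theorem dtil_three_one_zero : dtil (br [3, 1, 0]) = (3 : ℚ) • br [2, 1, 0] := by
  rw [dtil_br chain_three_one_zero]
  simp [dtilFun, Finset.sum_range_succ, br_of_not_chain, anickChain_triple]

theorem anickDelta_two_two_zero :
    anickDelta (br [2, 2, 0]) = (2 : ℚ) • br [2, 1] - (2 / 3 : ℚ) • br [3, 0] := by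
  have h12 : br [1, 2] = 0 := br_of_not_chain (by simp [anickChain_pair])
  have hIcc : Icc 1 2 = ({1, 2} : Finset ℕ) := rfl
  rw [anickDelta_br chain_two_two_zero]
  simp [deltaFun, ent, mergeAt, decAt, hIcc, h12]
  module

theorem anickDelta_three_one_zero :
    anickDelta (br [3, 1, 0]) = (3 : ℚ) • br [2, 1] - br [3, 0] := by
  rw [anickDelta_br chain_three_one_zero]
  simp [deltaFun, ent, mergeAt, decAt]
  module

theorem f3_ne_zero : f3 ≠ 0 := by
  intro h
  have := DFunLike.congr_fun h ⟨[2, 2, 0], chain_two_two_zero⟩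
  simp [f3, br_of_chain chain_two_two_zero, br_of_chain chain_three_one_zero] at this

theorem dtil_f3 : dtil f3 = 0 := by
  rw [f3, map_sub, map_smul, dtil_two_two_zero, dtil_three_one_zero]
  module

theorem anickDelta_f3 : anickDelta f3 = 0 := by
  rw [f3, map_sub, map_smul, anickDelta_two_two_zero, anickDelta_three_one_zero]
  module

theorem f3_mem_Kdeg : f3 ∈ Kdeg 3 4 := by
  refine ⟨⟨?_, dtil_f3⟩, ?_⟩ <;>
  exact Submodule.sub_mem _ (br_mem_supported (by simp))
    (Submodule.smul_mem _ _ (br_mem_supported (by simp)))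

/-- `K_3^{(4)}` is one-dimensional, spanned by `f_3`, and `δ_3(f_3) = 0`. -/
theorem Kdeg_three_four_spanned_by_f3 :
    Kdeg 3 4 = Submodule.span ℚ {f3} ∧ f3 ≠ 0 ∧ anickDelta f3 = 0 := by
  refine ⟨le_antisymm ?_ ?_, f3_ne_zero, anickDelta_f3⟩
  · rintro x ⟨⟨-, hker⟩, hdeg⟩
    rw [Adeg_three_four_eq_span] at hdeg
    obtain ⟨a, b, rfl⟩ := Submodule.mem_span_pair.mp hdeg
    have hcoef : (2 * a + 3 * b) • br [2, 1, 0] = 0 := by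
      rw [SetLike.mem_coe, LinearMap.mem_ker, map_add, map_smul, map_smul, dtil_two_two_zero,
        dtil_three_one_zero] at hker
      rw [← hker]
      module
    have hab : 2 * a + 3 * b = 0 :=
      (smul_eq_zero.mp hcoef).resolve_right (br_ne_zero (by simp [anickChain_triple]))
    obtain rfl : b = -(2 / 3) * a := by linarith
    refine Submodule.mem_span_singleton.mpr ⟨a, ?_⟩
    rw [f3]
    module
  · rw [Submodule.span_singleton_le_iff_mem]
    exact f3_mem_Kdeg
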